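/- Let ω₁, ω₂ be weights, 1 < p₁, p₂ < ∞, 1/p = 1/p₁ + 1/p₂, v = ω₁^{p/p₁} ω₂^{p/p₂}. If the strong-type bound ‖M(f,g)‖_{L^p(v)} ≤ C‖f‖_{L^{p₁}(ω₁)}‖g‖_{L^{p₂}(ω₂)} holds for all f ∈ L^{p₁}(ω₁), g ∈ L^{p₂}(ω₂), then (v, ω₁, ω₂) ∈ A_{p⃗} and E_n(f)E_n(g) → fg in L^p(v) for all such f, g. -/

import Mathlib

open MeasureTheory Filter ENNReal

noncomputable section

lemma aux_condMCT {Ω : Type*} {m m0 : MeasurableSpace Ω} {μ : Measure Ω} [IsProbabilityMeasure μ]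
    (hm : m ≤ m0) (f : Ω → ℝ) (hf : Integrable f μ) :
    ∀ᵐ x ∂μ, Tendsto (fun k : ℕ => (μ[fun y => min |f y| (k : ℝ)|m]) x) atTop
      (nhds ((μ[fun y => (|f y|)|m]) x)) := by
  have hint : ∀ k : ℕ, Integrable (fun y => min |f y| (k : ℝ)) μ := fun k =>
    hf.abs.inf (integrable_const _)
  have hlim := tendsto_condExpL1_of_dominated_convergence (μ := μ) hm
    (fs := fun (k : ℕ) y => min |f y| (k : ℝ)) (f := fun y => |f y|) (fun y => |f y|)
    (fun k => (hint k).aestronglyMeasurable) hf.abs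
    (fun k => Eventually.of_forall fun y => by
      rw [Real.norm_eq_abs, abs_of_nonneg (by positivity)]; exact min_le_left _ _)
    (Eventually.of_forall fun y => by
      obtain ⟨K, hK⟩ := exists_nat_ge |f y|
      refine tendsto_const_nhds.congr' ?_
      filter_upwards [eventually_ge_atTop K] with k hk
      rw [min_eq_left]
      exact hK.trans (by exact_mod_cast hk))
  have hmeas := tendstoInMeasure_of_tendsto_Lp hlim
  obtain ⟨ns, hns, hae⟩ := hmeas.exists_seq_tendsto_ae
  have hmono : ∀ k : ℕ, μ[fun y => min |f y| (k : ℝ)|m] ≤ᵐ[μ]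
      μ[fun y => min |f y| ((k+1 : ℕ) : ℝ)|m] := fun k =>
    condExp_mono (hint k) (hint (k+1)) (Eventually.of_forall fun y => by
      refine min_le_min le_rfl ?_
      push_cast; linarith)
  have hc : ∀ k : ℕ, _ := fun k => condExp_ae_eq_condExpL1 (μ := μ) hm (fun y => min |f y| (k : ℝ))
  filter_upwards [hae, ae_all_iff.2 hmono, ae_all_iff.2 hc,
    condExp_ae_eq_condExpL1 (μ := μ) hm (fun y => |f y|)] with x h1 h2 h3 h4
  have hM : Monotone (fun k : ℕ => (μ[fun y => min |f y| (k : ℝ)|m]) x) :=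
    monotone_nat_of_le_succ h2
  rw [tendsto_iff_tendsto_subseq_of_monotone hM hns.tendsto_atTop, h4]
  refine h1.congr fun i => ?_
  simp only [Function.comp, h3]

lemma aux_iff_bdd {Ω : Type*} {m0 : MeasurableSpace Ω} {μ : Measure Ω} [IsProbabilityMeasure μ]
    (ℱ : Filtration ℕ m0) (v : Ω → ℝ) (hv0 : ∀ x, 0 ≤ v x) (hv : Integrable v μ)
    (p : ℝ) (hp : 0 < p) (R : ℝ) (f g : Ω → ℝ) (K : NNReal)
    (hfK : ∀ x, |f x| ≤ K) (hgK : ∀ x, |g x| ≤ K)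
    (H : (∫ x, (⨆ n, ENNReal.ofReal
            (|(μ[f|ℱ n]) x| * |(μ[g|ℱ n]) x|)).toReal ^ p * v x ∂μ) ^ (1 / p) ≤ R) :
    ∫⁻ x, ⨆ n, ENNReal.ofReal ((|(μ[f|ℱ n]) x| * |(μ[g|ℱ n]) x|) ^ p * v x) ∂μ
      ≤ ENNReal.ofReal (R ^ p) := by
  set S : Ω → ℝ := fun x => (⨆ n, ENNReal.ofReal
            (|(μ[f|ℱ n]) x| * |(μ[g|ℱ n]) x|)).toReal with hS
  have hSm : Measurable S := by
    refine Measurable.ennreal_toReal (Measurable.iSup fun n => ?_)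
    have h1 : Measurable (μ[f|ℱ n]) := (stronglyMeasurable_condExp.mono (ℱ.le n)).measurable
    have h2 : Measurable (μ[g|ℱ n]) := (stronglyMeasurable_condExp.mono (ℱ.le n)).measurable
    fun_prop
  have hb : ∀ᵐ x ∂μ, (⨆ n, ENNReal.ofReal
            (|(μ[f|ℱ n]) x| * |(μ[g|ℱ n]) x|)) ≤ ENNReal.ofReal (K * K) := by
    have a1 : ∀ n, ∀ᵐ x ∂μ, |(μ[f|ℱ n]) x| ≤ K := fun n =>
      ae_bdd_abs_condExp_of_ae_bdd_abs (Eventually.of_forall hfK)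
    have a2 : ∀ n, ∀ᵐ x ∂μ, |(μ[g|ℱ n]) x| ≤ K := fun n =>
      ae_bdd_abs_condExp_of_ae_bdd_abs (Eventually.of_forall hgK)
    filter_upwards [ae_all_iff.2 a1, ae_all_iff.2 a2] with x h1 h2
    refine iSup_le fun n => ENNReal.ofReal_le_ofReal ?_
    exact mul_le_mul (h1 n) (h2 n) (abs_nonneg _) K.2
  have hSi : Integrable (fun x => S x ^ p * v x) μ := by
    refine hv.bdd_mul (c := ((K : ℝ) * K) ^ p) ?_ ?_
    · exact (hSm.pow_const p).aestronglyMeasurable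
    · filter_upwards [hb] with x hx
      have : 0 ≤ S x := ENNReal.toReal_nonneg
      rw [Real.norm_eq_abs, abs_of_nonneg (by positivity)]
      refine Real.rpow_le_rpow this ?_ hp.le
      exact ENNReal.toReal_le_of_le_ofReal (by positivity) hx
  have hI0 : 0 ≤ ∫ x, S x ^ p * v x ∂μ := integral_nonneg fun x =>
    mul_nonneg (Real.rpow_nonneg ENNReal.toReal_nonneg _) (hv0 x)
  have hIR : ∫ x, S x ^ p * v x ∂μ ≤ R ^ p := by
    have := Real.rpow_le_rpow (Real.rpow_nonneg hI0 _) H hp.le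
    rwa [← Real.rpow_mul hI0, one_div_mul_cancel hp.ne', Real.rpow_one] at this
  calc _ ≤ ∫⁻ x, ENNReal.ofReal (S x ^ p * v x) ∂μ := by
        refine lintegral_mono_ae ?_
        filter_upwards [hb] with x hx
        refine iSup_le fun n => ENNReal.ofReal_le_ofReal ?_
        refine mul_le_mul_of_nonneg_right ?_ (hv0 x)
        refine Real.rpow_le_rpow (by positivity) ?_ hp.le
        refine (ENNReal.ofReal_le_iff_le_toReal (ne_top_of_le_ne_top ENNReal.ofReal_ne_top hx)).1 ?_
        exact le_iSup (fun n => ENNReal.ofReal (|(μ[f|ℱ n]) x| * |(μ[g|ℱ n]) x|)) n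
    _ = ENNReal.ofReal (∫ x, S x ^ p * v x ∂μ) := by
        rw [ofReal_integral_eq_lintegral_ofReal hSi (Eventually.of_forall fun x =>
          mul_nonneg (Real.rpow_nonneg ENNReal.toReal_nonneg _) (hv0 x))]
    _ ≤ _ := ENNReal.ofReal_le_ofReal hIR

lemma aux_strong {Ω : Type*} {m0 : MeasurableSpace Ω} {μ : Measure Ω} [IsProbabilityMeasure μ]
    (ℱ : Filtration ℕ m0) (ω₁ ω₂ v : Ω → ℝ) (hω₁ : ∀ x, 0 < ω₁ x) (hω₂ : ∀ x, 0 < ω₂ x)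
    (hv0 : ∀ x, 0 ≤ v x) (hv : Integrable v μ)
    (hω₁I : Integrable ω₁ μ) (hω₂I : Integrable ω₂ μ)
    (p p₁ p₂ C : ℝ) (hp : 0 < p) (hp₁ : 1 < p₁) (hp₂ : 1 < p₂) (hC : 0 < C)
    (H : ∀ f g : Ω → ℝ, Integrable f μ →
      Integrable (fun x => |f x| ^ p₁ * ω₁ x) μ →
      Integrable g μ →
      Integrable (fun x => |g x| ^ p₂ * ω₂ x) μ →
      (∫ x, (⨆ n, ENNReal.ofReal
            (|(μ[f|ℱ n]) x| * |(μ[g|ℱ n]) x|)).toReal ^ p * v x ∂μ) ^ (1 / p)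
        ≤ C * (∫ x, |f x| ^ p₁ * ω₁ x ∂μ) ^ (1 / p₁)
            * (∫ x, |g x| ^ p₂ * ω₂ x ∂μ) ^ (1 / p₂))
    (f g : Ω → ℝ) (hf : Integrable f μ)
    (hf1 : Integrable (fun x => |f x| ^ p₁ * ω₁ x) μ)
    (hg : Integrable g μ)
    (hg1 : Integrable (fun x => |g x| ^ p₂ * ω₂ x) μ) :
    ∫⁻ x, ⨆ n, ENNReal.ofReal ((|(μ[f|ℱ n]) x| * |(μ[g|ℱ n]) x|) ^ p * v x) ∂μ
      ≤ ENNReal.ofReal ((C * (∫ x, |f x| ^ p₁ * ω₁ x ∂μ) ^ (1 / p₁)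
            * (∫ x, |g x| ^ p₂ * ω₂ x ∂μ) ^ (1 / p₂)) ^ p) := by
  have tr : ∀ (h w : Ω → ℝ) (q : ℝ), 1 < q → (∀ x, 0 < w x) → Integrable w μ → Integrable h μ →
      Integrable (fun x => |h x| ^ q * w x) μ → ∀ k : ℕ,
      Integrable (fun y => min |h y| (k : ℝ)) μ ∧
      Integrable (fun x => |min |h x| (k : ℝ)| ^ q * w x) μ ∧
      (∫ x, |min |h x| (k : ℝ)| ^ q * w x ∂μ) ≤ ∫ x, |h x| ^ q * w x ∂μ := by
    intro h w q hq hw hwI hh hhI k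
    have i1 : Integrable (fun y => min |h y| (k : ℝ)) μ := hh.abs.inf (integrable_const _)
    have le : ∀ x, |min |h x| (k : ℝ)| ^ q * w x ≤ |h x| ^ q * w x := fun x => by
      refine mul_le_mul_of_nonneg_right ?_ (hw x).le
      refine Real.rpow_le_rpow (abs_nonneg _) ?_ (by linarith)
      rw [abs_of_nonneg (by positivity)]; exact min_le_left _ _
    have i2 : Integrable (fun x => |min |h x| (k : ℝ)| ^ q * w x) μ := by
      refine hhI.mono ?_ (Eventually.of_forall fun x => ?_)
      · have := i1.aestronglyMeasurable.aemeasurable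
        have hw' := hwI.aestronglyMeasurable.aemeasurable
        exact AEMeasurable.aestronglyMeasurable (by fun_prop)
      · have := (hw x).le
        rw [Real.norm_of_nonneg (by positivity), Real.norm_of_nonneg (by positivity)]
        exact le x
    exact ⟨i1, i2, integral_mono i2 hhI le⟩
  have T1 := tr f ω₁ p₁ hp₁ hω₁ hω₁I hf hf1
  have T2 := tr g ω₂ p₂ hp₂ hω₂ hω₂I hg hg1
  set R := C * (∫ x, |f x| ^ p₁ * ω₁ x ∂μ) ^ (1 / p₁)
            * (∫ x, |g x| ^ p₂ * ω₂ x ∂μ) ^ (1 / p₂) with hR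
  have n1 : ∀ (h w : Ω → ℝ) (q : ℝ), (∀ x, 0 < w x) → 0 ≤ ∫ x, |h x| ^ q * w x ∂μ :=
    fun h w q hw => integral_nonneg fun x => by have := (hw x).le; positivity
  let fk : ℕ → Ω → ℝ := fun k y => min |f y| (k : ℝ)
  let gk : ℕ → Ω → ℝ := fun k y => min |g y| (k : ℝ)
  have B : ∀ k : ℕ, ∫⁻ x, ⨆ n, ENNReal.ofReal
      ((|(μ[fk k|ℱ n]) x| * |(μ[gk k|ℱ n]) x|) ^ p * v x) ∂μ ≤ ENNReal.ofReal (R ^ p) := by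
    intro k
    refine aux_iff_bdd ℱ v hv0 hv p hp R (fk k) (gk k) (k : NNReal) ?_ ?_ ?_
    · intro x
      simp only [fk]
      rw [abs_of_nonneg (by positivity)]; exact min_le_right _ _
    · intro x
      simp only [gk]
      rw [abs_of_nonneg (by positivity)]; exact min_le_right _ _
    · refine (H (fk k) (gk k) (T1 k).1 (T1 k).2.1 (T2 k).1 (T2 k).2.1).trans ?_
      have := n1 (fk k) ω₁ p₁ hω₁
      have := n1 (gk k) ω₂ p₂ hω₂
      have := n1 f ω₁ p₁ hω₁
      rw [hR]
      gcongr ?_ * ?_ * ?_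
      · exact Real.rpow_le_rpow (n1 (fk k) ω₁ p₁ hω₁) (T1 k).2.2 (by positivity)
      · exact Real.rpow_le_rpow (n1 (gk k) ω₂ p₂ hω₂) (T2 k).2.2 (by positivity)
  have key : ∀ᵐ x ∂μ, (⨆ n, ENNReal.ofReal ((|(μ[f|ℱ n]) x| * |(μ[g|ℱ n]) x|) ^ p * v x)) ≤
      liminf (fun k => ⨆ n, ENNReal.ofReal
      ((|(μ[fk k|ℱ n]) x| * |(μ[gk k|ℱ n]) x|) ^ p * v x)) atTop := by
    have c1 := fun n => aux_condMCT (μ := μ) (ℱ.le n) f hf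
    have c2 := fun n => aux_condMCT (μ := μ) (ℱ.le n) g hg
    have d1 : ∀ n, |μ[f|ℱ n]| ≤ᵐ[μ] _ := fun n => abs_condExp_ae_le_condExp_abs (μ := μ) (m := ℱ n) f
    have d2 : ∀ n, |μ[g|ℱ n]| ≤ᵐ[μ] _ := fun n => abs_condExp_ae_le_condExp_abs (μ := μ) (m := ℱ n) g
    filter_upwards [ae_all_iff.2 c1, ae_all_iff.2 c2, ae_all_iff.2 d1, ae_all_iff.2 d2] with
      x h1 h2 h3 h4
    refine iSup_le fun n => ?_
    have t : Tendsto (fun k => ENNReal.ofReal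
      ((|(μ[fk k|ℱ n]) x| * |(μ[gk k|ℱ n]) x|) ^ p * v x)) atTop
      (nhds (ENNReal.ofReal ((|(μ[fun y => (|f y|)|ℱ n]) x| * |(μ[fun y => (|g y|)|ℱ n]) x|) ^ p * v x))) := by
      refine ENNReal.tendsto_ofReal (Tendsto.mul_const _ ?_)
      exact (((h1 n).abs.mul (h2 n).abs)).rpow_const (Or.inr hp.le)
    have e1 : |(μ[f|ℱ n]) x| ≤ |(μ[fun y => (|f y|)|ℱ n]) x| := (h3 n).trans (le_abs_self _)
    have e2 : |(μ[g|ℱ n]) x| ≤ |(μ[fun y => (|g y|)|ℱ n]) x| := (h4 n).trans (le_abs_self _)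
    calc _ ≤ ENNReal.ofReal ((|(μ[fun y => (|f y|)|ℱ n]) x| * |(μ[fun y => (|g y|)|ℱ n]) x|) ^ p * v x) := by
          have := hv0 x
          gcongr
      _ = _ := t.liminf_eq.symm
      _ ≤ _ := liminf_le_liminf (Eventually.of_forall fun k =>
          le_iSup (fun n => ENNReal.ofReal
            ((|(μ[fk k|ℱ n]) x| * |(μ[gk k|ℱ n]) x|) ^ p * v x)) n)
  refine (lintegral_mono_ae key).trans ((lintegral_liminf_le' fun k => ?_).trans ?_)
  · refine AEMeasurable.iSup fun n => ?_
    have h1 : Measurable (μ[fk k|ℱ n]) := (stronglyMeasurable_condExp.mono (ℱ.le n)).measurable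
    have h2 : Measurable (μ[gk k|ℱ n]) := (stronglyMeasurable_condExp.mono (ℱ.le n)).measurable
    have h3 := hv.aestronglyMeasurable.aemeasurable
    fun_prop
  · refine (liminf_le_liminf (Eventually.of_forall B)).trans ?_
    simp

lemma aux_cond_le {Ω : Type*} {m m0 : MeasurableSpace Ω} {μ : Measure Ω} [IsProbabilityMeasure μ]
    (hm : m ≤ m0) (f g : Ω → ℝ) (hf : Integrable f μ) (hg : Integrable g μ)
    (h : ∀ A, MeasurableSet[m] A → ∫ x in A, f x ∂μ ≤ ∫ x in A, g x ∂μ) :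
    μ[f|m] ≤ᵐ[μ] μ[g|m] := by
  have h1 : StronglyMeasurable[m] (μ[f|m]) := stronglyMeasurable_condExp
  have h2 : StronglyMeasurable[m] (μ[g|m]) := stronglyMeasurable_condExp
  refine ae_le_of_ae_le_trim (hm := hm) ?_
  refine ae_le_of_forall_setIntegral_le (integrable_condExp.trim hm h1)
    (integrable_condExp.trim hm h2) ?_
  intro A hA _
  rw [← setIntegral_trim hm h1 hA, ← setIntegral_trim hm h2 hA,
    setIntegral_condExp hm hf hA, setIntegral_condExp hm hg hA]
  exact h A hA

lemma aux_amgm (θ₁ θ₂ r x y : ℝ) (h1 : 0 ≤ θ₁) (h2 : 0 ≤ θ₂) (h : θ₁ + θ₂ = 1) (hx : 0 ≤ x)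
    (hy : 0 ≤ y) :
    x ^ θ₁ * y ^ θ₂ ≤ θ₁ * (Real.exp (r * θ₂) * x) + θ₂ * (Real.exp (-(r * θ₁)) * y) := by
  have := Real.geom_mean_le_arith_mean2_weighted h1 h2
    (mul_nonneg (Real.exp_pos (r * θ₂)).le hx) (mul_nonneg (Real.exp_pos (-(r * θ₁))).le hy) h
  refine le_trans (le_of_eq ?_) this
  rw [Real.mul_rpow (Real.exp_pos _).le hx, Real.mul_rpow (Real.exp_pos _).le hy,
    ← Real.exp_mul, ← Real.exp_mul]
  have e : Real.exp (r * θ₂ * θ₁) * Real.exp (-(r * θ₁) * θ₂) = 1 := by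
    rw [← Real.exp_add, ← Real.exp_zero]; congr 1; ring
  calc _ = (Real.exp (r * θ₂ * θ₁) * Real.exp (-(r * θ₁) * θ₂)) * (x ^ θ₁ * y ^ θ₂) := by
        rw [e, one_mul]
    _ = _ := by ring

lemma aux_inf (θ₁ θ₂ a b c K : ℝ) (h : θ₁ + θ₂ = 1) (hb : 0 < b) (hc : 0 < c)
    (H : ∀ r : ℚ, a ≤ K * (θ₁ * (Real.exp (r * θ₂) * b) + θ₂ * (Real.exp (-(r * θ₁)) * c))) :
    a ≤ K * (b ^ θ₁ * c ^ θ₂) := by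
  have H' : ∀ r : ℝ, a ≤ K * (θ₁ * (Real.exp (r * θ₂) * b) + θ₂ * (Real.exp (-(r * θ₁)) * c)) := by
    intro r
    refine (Rat.denseRange_cast (𝕜 := ℝ)).induction_on
      (p := fun r : ℝ => a ≤ K * (θ₁ * (Real.exp (r * θ₂) * b) + θ₂ * (Real.exp (-(r * θ₁)) * c)))
      r ?_ H
    exact isClosed_le continuous_const (by fun_prop)
  refine (H' (Real.log c - Real.log b)).trans (le_of_eq ?_)
  have e1 : Real.exp ((Real.log c - Real.log b) * θ₂) * b = b ^ θ₁ * c ^ θ₂ := by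
    rw [Real.rpow_def_of_pos hb, Real.rpow_def_of_pos hc]
    nth_rewrite 2 [← Real.exp_log hb]
    rw [← Real.exp_add, ← Real.exp_add]
    congr 1
    have : θ₁ = 1 - θ₂ := by linarith
    rw [this]; ring
  have e2 : Real.exp (-((Real.log c - Real.log b) * θ₁)) * c = b ^ θ₁ * c ^ θ₂ := by
    rw [Real.rpow_def_of_pos hb, Real.rpow_def_of_pos hc]
    nth_rewrite 2 [← Real.exp_log hc]
    rw [← Real.exp_add, ← Real.exp_add]
    congr 1
    have : θ₁ = 1 - θ₂ := by linarith
    rw [this]; ring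
  rw [e1, e2, ← add_mul, h, one_mul]

lemma aux_final (p p₁ p₂ C V b c : ℝ) (hp : 0 < p) (hp₁ : 1 < p₁) (hp₂ : 1 < p₂) (hC : 0 < C)
    (hV : 0 ≤ V) (hb : 0 < b) (hc : 0 < c)
    (h : (b * c) ^ p * V ≤ C ^ p * (b ^ (p / p₁) * c ^ (p / p₂))) :
    V ^ (1 / p) * b ^ ((p₁ - 1) / p₁) * c ^ ((p₂ - 1) / p₂) ≤ C := by
  have h' := Real.rpow_le_rpow (by positivity) h (by positivity : 0 ≤ 1 / p)
  rw [Real.mul_rpow (by positivity) hV, ← Real.rpow_mul (mul_pos hb hc).le,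
    Real.mul_rpow (x := C ^ p) (by positivity) (by positivity),
    Real.mul_rpow (x := b ^ (p / p₁)) (by positivity) (by positivity),
    ← Real.rpow_mul hC.le, ← Real.rpow_mul hb.le, ← Real.rpow_mul hc.le,
    mul_one_div_cancel hp.ne', Real.rpow_one, Real.rpow_one] at h'
  have q1 : p / p₁ * (1 / p) = 1 / p₁ := by field_simp
  have q2 : p / p₂ * (1 / p) = 1 / p₂ := by field_simp
  rw [q1, q2] at h'
  have b1 : b = b ^ (1 / p₁) * b ^ ((p₁ - 1) / p₁) := by
    rw [← Real.rpow_add hb, ← add_div]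
    have : (1 + (p₁ - 1)) / p₁ = 1 := by field_simp; ring
    rw [this, Real.rpow_one]
  have c1 : c = c ^ (1 / p₂) * c ^ ((p₂ - 1) / p₂) := by
    rw [← Real.rpow_add hc, ← add_div]
    have : (1 + (p₂ - 1)) / p₂ = 1 := by field_simp; ring
    rw [this, Real.rpow_one]
  have pos : 0 < b ^ (1 / p₁) * c ^ (1 / p₂) := by positivity
  refine le_of_mul_le_mul_right ?_ pos
  refine le_trans (le_of_eq ?_) h'
  calc _ = (b ^ (1 / p₁) * b ^ ((p₁ - 1) / p₁)) * (c ^ (1 / p₂) * c ^ ((p₂ - 1) / p₂))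
        * V ^ (1 / p) := by ring
    _ = _ := by rw [← b1, ← c1]

lemma aux_sigma {Ω : Type*} {m0 : MeasurableSpace Ω} {μ : Measure Ω} (w : Ω → ℝ)
    (hw : ∀ x, 0 < w x) (q : ℝ) (hq : 1 < q)
    (hI : Integrable (fun x => w x ^ (-(1 / (q - 1)))) μ) (A : Set Ω) (hA : MeasurableSet A) :
    Integrable (fun x => |A.indicator (fun x => w x ^ (-(1 / (q - 1)))) x| ^ q * w x) μ ∧
    ∫ x, |A.indicator (fun x => w x ^ (-(1 / (q - 1)))) x| ^ q * w x ∂μ =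
      ∫ x in A, w x ^ (-(1 / (q - 1))) ∂μ := by
  have e : (fun x => |A.indicator (fun x => w x ^ (-(1 / (q - 1)))) x| ^ q * w x) =
      A.indicator (fun x => w x ^ (-(1 / (q - 1)))) := by
    funext x
    by_cases hx : x ∈ A
    · simp only [Set.indicator_of_mem hx]
      rw [abs_of_pos (Real.rpow_pos_of_pos (hw x) _), ← Real.rpow_mul (hw x).le]
      nth_rewrite 2 [← Real.rpow_one (w x)]
      rw [← Real.rpow_add (hw x)]
      congr 1
      have : q - 1 ≠ 0 := by linarith
      field_simp
      ring
    · simp [Set.indicator_of_notMem hx, Real.zero_rpow (by linarith : q ≠ 0)]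
  rw [e]
  exact ⟨hI.indicator hA, integral_indicator hA⟩

theorem stmt_14
    {Ω : Type*} {m0 : MeasurableSpace Ω} {μ : Measure Ω} [IsProbabilityMeasure μ]
    (ℱ : Filtration ℕ m0) (hgen : m0 = ⨆ n, ℱ n)
    (ω₁ ω₂ v : Ω → ℝ)
    (hω₁ : ∀ x, 0 < ω₁ x) (hω₂ : ∀ x, 0 < ω₂ x)
    (hω₁I : Integrable ω₁ μ) (hω₂I : Integrable ω₂ μ)
    (p p₁ p₂ C : ℝ) (hp₁ : 1 < p₁) (hp₂ : 1 < p₂)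
    (hp : 1 / p = 1 / p₁ + 1 / p₂) (hC : 0 < C)
    (hσ₁I : Integrable (fun x => ω₁ x ^ (-(1 / (p₁ - 1)))) μ)
    (hσ₂I : Integrable (fun x => ω₂ x ^ (-(1 / (p₂ - 1)))) μ)
    (hvdef : v = fun x => ω₁ x ^ (p / p₁) * ω₂ x ^ (p / p₂))
    (H : ∀ f g : Ω → ℝ, Integrable f μ →
      Integrable (fun x => |f x| ^ p₁ * ω₁ x) μ →
      Integrable g μ →
      Integrable (fun x => |g x| ^ p₂ * ω₂ x) μ →
      (∫ x, (⨆ n, ENNReal.ofReal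
            (|(μ[f|ℱ n]) x| * |(μ[g|ℱ n]) x|)).toReal ^ p * v x ∂μ) ^ (1 / p)
        ≤ C * (∫ x, |f x| ^ p₁ * ω₁ x ∂μ) ^ (1 / p₁)
            * (∫ x, |g x| ^ p₂ * ω₂ x ∂μ) ^ (1 / p₂)) :
    (∃ C' : ℝ, 0 < C' ∧ ∀ n : ℕ, ∀ᵐ x ∂μ,
      (μ[v|ℱ n]) x ^ (1 / p)
        * (μ[fun y => ω₁ y ^ (-(1 / (p₁ - 1)))|ℱ n]) x ^ ((p₁ - 1) / p₁)
        * (μ[fun y => ω₂ y ^ (-(1 / (p₂ - 1)))|ℱ n]) x ^ ((p₂ - 1) / p₂) ≤ C')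
    ∧ ∀ f g : Ω → ℝ, Integrable f μ →
      Integrable (fun x => |f x| ^ p₁ * ω₁ x) μ →
      Integrable g μ →
      Integrable (fun x => |g x| ^ p₂ * ω₂ x) μ →
      Tendsto (fun n : ℕ => ∫ x, |(μ[f|ℱ n]) x * (μ[g|ℱ n]) x - f x * g x| ^ p * v x ∂μ)
        atTop (nhds 0) := by
  have hp1 : 0 < 1 / p := by rw [hp]; positivity
  have hp0 : 0 < p := one_div_pos.1 hp1
  have hθ : p / p₁ + p / p₂ = 1 := by
    have : p / p₁ + p / p₂ = p * (1 / p₁ + 1 / p₂) := by ring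
    rw [this, ← hp, mul_one_div_cancel hp0.ne']
  have hθ₁ : 0 ≤ p / p₁ := by positivity
  have hθ₂ : 0 ≤ p / p₂ := by positivity
  have hv0 : ∀ x, 0 ≤ v x := fun x => by
    have := hω₁ x
    have := hω₂ x
    rw [hvdef]; positivity
  have hv : Integrable v μ := by
    refine ((hω₁I.const_mul (p / p₁)).add (hω₂I.const_mul (p / p₂))).mono ?_
      (Eventually.of_forall fun x => ?_)
    · have h1 := hω₁I.aestronglyMeasurable.aemeasurable
      have h2 := hω₂I.aestronglyMeasurable.aemeasurable
      rw [hvdef]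
      exact AEMeasurable.aestronglyMeasurable (by fun_prop)
    · rw [Real.norm_of_nonneg (hv0 x)]
      refine le_trans ?_ (le_abs_self _)
      rw [hvdef]
      exact Real.geom_mean_le_arith_mean2_weighted hθ₁ hθ₂ (hω₁ x).le (hω₂ x).le hθ
  have S := aux_strong ℱ ω₁ ω₂ v hω₁ hω₂ hv0 hv hω₁I hω₂I p p₁ p₂ C hp0 hp₁ hp₂ hC H
  have hvm := hv.aestronglyMeasurable.aemeasurable
  constructor
  · refine ⟨C, hC, fun n => ?_⟩
    set σ₁ : Ω → ℝ := fun y => ω₁ y ^ (-(1 / (p₁ - 1))) with hσ₁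
    set σ₂ : Ω → ℝ := fun y => ω₂ y ^ (-(1 / (p₂ - 1))) with hσ₂
    have s1 : ∀ x, 0 ≤ σ₁ x := fun x => Real.rpow_nonneg (hω₁ x).le _
    have s2 : ∀ x, 0 ≤ σ₂ x := fun x => Real.rpow_nonneg (hω₂ x).le _
    have mb : StronglyMeasurable[ℱ n] (μ[σ₁|ℱ n]) := stronglyMeasurable_condExp
    have mc : StronglyMeasurable[ℱ n] (μ[σ₂|ℱ n]) := stronglyMeasurable_condExp
    have mb' : Measurable (μ[σ₁|ℱ n]) := (mb.mono (ℱ.le n)).measurable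
    have mc' : Measurable (μ[σ₂|ℱ n]) := (mc.mono (ℱ.le n)).measurable
    let W : Ω → ℝ := fun x => (|(μ[σ₁|ℱ n]) x| * |(μ[σ₂|ℱ n]) x|) ^ p
    have hW0 : ∀ x, 0 ≤ W x := fun x => Real.rpow_nonneg (by positivity) _
    have hWm : StronglyMeasurable[ℱ n] W := by
      have h1 := mb.measurable
      have h2 := mc.measurable
      have : Measurable[ℱ n] W := by
        refine Measurable.pow_const (Measurable.mul ?_ ?_) p
        · exact measurable_abs.comp h1
        · exact measurable_abs.comp h2
      exact this.stronglyMeasurable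
    have hA : ∀ A, MeasurableSet[ℱ n] A → ∫⁻ x in A, ENNReal.ofReal (W x * v x) ∂μ ≤
        ENNReal.ofReal ((C * (∫ x in A, σ₁ x ∂μ) ^ (1 / p₁) * (∫ x in A, σ₂ x ∂μ) ^ (1 / p₂)) ^ p) := by
      intro A hA
      have hA' := ℱ.le n A hA
      obtain ⟨i1, j1⟩ := aux_sigma (μ := μ) ω₁ hω₁ p₁ hp₁ hσ₁I A hA'
      obtain ⟨i2, j2⟩ := aux_sigma (μ := μ) ω₂ hω₂ p₂ hp₂ hσ₂I A hA'
      have := S (A.indicator σ₁) (A.indicator σ₂) (hσ₁I.indicator hA') i1 (hσ₂I.indicator hA') i2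
      rw [j1, j2] at this
      refine le_trans ?_ this
      rw [← lintegral_indicator hA']
      refine lintegral_mono_ae ?_
      filter_upwards [condExp_indicator (μ := μ) hσ₁I hA, condExp_indicator (μ := μ) hσ₂I hA]
        with x h1 h2
      refine le_trans ?_ (le_iSup (fun n => ENNReal.ofReal ((|(μ[A.indicator σ₁|ℱ n]) x| *
        |(μ[A.indicator σ₂|ℱ n]) x|) ^ p * v x)) n)
      by_cases hx : x ∈ A
      · rw [h1, h2]
        simp only [Set.indicator_of_mem hx]
        exact le_rfl
      · simp [Set.indicator_of_notMem hx]
    have hWv0 : ∀ x, 0 ≤ W x * v x := fun x => mul_nonneg (hW0 x) (hv0 x)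
    have hWvm : AEStronglyMeasurable (fun x => W x * v x) μ :=
      (hWm.mono (ℱ.le n)).aestronglyMeasurable.mul hv.aestronglyMeasurable
    have hWI : Integrable (fun x => W x * v x) μ := by
      refine ⟨hWvm, ?_⟩
      rw [hasFiniteIntegral_iff_ofReal (Eventually.of_forall hWv0)]
      have := hA Set.univ MeasurableSet.univ
      rw [Measure.restrict_univ] at this
      exact this.trans_lt ENNReal.ofReal_lt_top
    have hB : ∀ A, MeasurableSet[ℱ n] A → ∫ x in A, W x * v x ∂μ ≤
        C ^ p * ((∫ x in A, σ₁ x ∂μ) ^ (p / p₁) * (∫ x in A, σ₂ x ∂μ) ^ (p / p₂)) := by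
      intro A hA1
      have n1 : 0 ≤ ∫ x in A, σ₁ x ∂μ := integral_nonneg s1
      have n2 : 0 ≤ ∫ x in A, σ₂ x ∂μ := integral_nonneg s2
      have := hA A hA1
      rw [← ofReal_integral_eq_lintegral_ofReal hWI.integrableOn (Eventually.of_forall hWv0),
        ENNReal.ofReal_le_ofReal_iff (by positivity)] at this
      refine this.trans (le_of_eq ?_)
      rw [Real.mul_rpow (by positivity) (by positivity), Real.mul_rpow (by positivity) (by positivity),
        ← Real.rpow_mul n1, ← Real.rpow_mul n2, one_div_mul_eq_div, one_div_mul_eq_div, mul_assoc]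
    have hQ : ∀ r : ℚ, ∀ᵐ x ∂μ, (μ[fun x => W x * v x|ℱ n]) x ≤ C ^ p *
        (p / p₁ * (Real.exp (r * (p / p₂)) * (μ[σ₁|ℱ n]) x) +
          p / p₂ * (Real.exp (-(r * (p / p₁))) * (μ[σ₂|ℱ n]) x)) := by
      intro r
      set α := C ^ p * (p / p₁ * Real.exp (r * (p / p₂))) with hα
      set β := C ^ p * (p / p₂ * Real.exp (-(r * (p / p₁)))) with hβ
      have iα : Integrable (α • σ₁) μ := hσ₁I.smul α
      have iβ : Integrable (β • σ₂) μ := hσ₂I.smul β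
      have := aux_cond_le (ℱ.le n) (fun x => W x * v x) (α • σ₁ + β • σ₂) hWI (iα.add iβ) (by
        intro A hA1
        have n1 : 0 ≤ ∫ x in A, σ₁ x ∂μ := integral_nonneg s1
        have n2 : 0 ≤ ∫ x in A, σ₂ x ∂μ := integral_nonneg s2
        refine (hB A hA1).trans ?_
        refine (mul_le_mul_of_nonneg_left (aux_amgm (p / p₁) (p / p₂) r _ _ hθ₁ hθ₂ hθ n1 n2)
          (Real.rpow_nonneg hC.le p)).trans (le_of_eq ?_)
        simp only [Pi.add_apply]
        rw [integral_add iα.integrableOn iβ.integrableOn]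
        simp only [Pi.smul_apply, smul_eq_mul, integral_const_mul]
        rw [hα, hβ]; ring)
      filter_upwards [this, condExp_add iα iβ (ℱ n), condExp_smul (μ := μ) α σ₁ (ℱ n),
        condExp_smul (μ := μ) β σ₂ (ℱ n)] with x h1 h2 h3 h4
      rw [h2, Pi.add_apply, h3, h4, Pi.smul_apply, Pi.smul_apply, smul_eq_mul, smul_eq_mul] at h1
      refine h1.trans (le_of_eq ?_)
      rw [hα, hβ]; ring
    have hpull : μ[fun x => W x * v x|ℱ n] =ᵐ[μ] W * μ[v|ℱ n] :=
      condExp_mul_of_stronglyMeasurable_left hWm hWI hv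
    filter_upwards [ae_all_iff.2 hQ, hpull,
      condExp_nonneg (μ := μ) (m := ℱ n) (Eventually.of_forall hv0 : 0 ≤ᵐ[μ] v),
      condExp_nonneg (μ := μ) (m := ℱ n) (Eventually.of_forall s1 : 0 ≤ᵐ[μ] σ₁),
      condExp_nonneg (μ := μ) (m := ℱ n) (Eventually.of_forall s2 : 0 ≤ᵐ[μ] σ₂)] with x h1 h2 h3 h4 h5
    simp only [Pi.zero_apply] at h3 h4 h5
    have z1 : (p₁ - 1) / p₁ ≠ 0 := (div_pos (by linarith) (by linarith)).ne'
    have z2 : (p₂ - 1) / p₂ ≠ 0 := (div_pos (by linarith) (by linarith)).ne'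
    rcases h4.eq_or_lt with h4 | h4
    · rw [← h4, Real.zero_rpow z1]; simpa using hC.le
    rcases h5.eq_or_lt with h5 | h5
    · rw [← h5, Real.zero_rpow z2]; simpa using hC.le
    refine aux_final p p₁ p₂ C _ _ _ hp0 hp₁ hp₂ hC h3 h4 h5 ?_
    have := aux_inf _ _ _ _ _ _ hθ h4 h5 h1
    rw [h2] at this
    simpa only [Pi.mul_apply, W, abs_of_pos h4, abs_of_pos h5] using this
  · intro f g hf hf1 hg hg1
    have hS := S f g hf hf1 hg hg1
    have mf : ∀ n, Measurable (μ[f|ℱ n]) := fun n =>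
      (stronglyMeasurable_condExp.mono (ℱ.le n)).measurable
    have mg : ∀ n, Measurable (μ[g|ℱ n]) := fun n =>
      (stronglyMeasurable_condExp.mono (ℱ.le n)).measurable
    have hlev : ∀ h : Ω → ℝ, Integrable h μ →
        ∀ᵐ x ∂μ, Tendsto (fun n => (μ[h|ℱ n]) x) atTop (nhds (h x)) := by
      intro h hh
      have h1 := tendsto_ae_condExp (μ := μ) (ℱ := ℱ) h
      rw [← hgen] at h1
      have h2 : μ[h|m0] =ᵐ[μ] h :=
        condExp_of_aestronglyMeasurable' le_rfl hh.aestronglyMeasurable hh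
      filter_upwards [h1, h2] with x a b
      rwa [b] at a
    set F : Ω → ENNReal := fun x =>
      ⨆ n, ENNReal.ofReal ((|(μ[f|ℱ n]) x| * |(μ[g|ℱ n]) x|) ^ p * v x) with hF
    have hFm : AEMeasurable F μ := by
      refine AEMeasurable.iSup fun n => ?_
      have h1 := mf n
      have h2 := mg n
      fun_prop
    have hFt : ∫⁻ x, F x ∂μ ≠ ∞ := ne_top_of_le_ne_top ENNReal.ofReal_ne_top hS
    have hFI : Integrable (fun x => (F x).toReal) μ := integrable_toReal_of_lintegral_ne_top hFm hFt
    have hF1 : ∀ᵐ x ∂μ, F x < ∞ := ae_lt_top' hFm hFt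
    have hlim : ∀ᵐ x ∂μ, Tendsto (fun n : ℕ =>
        |(μ[f|ℱ n]) x * (μ[g|ℱ n]) x - f x * g x| ^ p * v x) atTop (nhds 0) := by
      filter_upwards [hlev f hf, hlev g hg] with x h1 h2
      have h3 := (((h1.mul h2).sub_const (f x * g x)).abs.rpow_const (Or.inr hp0.le)).mul_const (v x)
      simpa [Real.zero_rpow hp0.ne'] using h3
    have := tendsto_integral_of_dominated_convergence (μ := μ)
      (F := fun (n : ℕ) x => |(μ[f|ℱ n]) x * (μ[g|ℱ n]) x - f x * g x| ^ p * v x)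
      (f := fun _ => (0 : ℝ)) (fun x => 2 ^ p * (F x).toReal) ?_ (hFI.const_mul _) ?_ hlim
    · simpa using this
    · intro n
      have h1 := mf n
      have h2 := mg n
      have h3 := hf.aestronglyMeasurable.aemeasurable
      have h4 := hg.aestronglyMeasurable.aemeasurable
      refine AEMeasurable.aestronglyMeasurable (AEMeasurable.mul (AEMeasurable.pow_const ?_ p) hvm)
      exact measurable_abs.comp_aemeasurable (by fun_prop)
    · intro n
      filter_upwards [hlev f hf, hlev g hg, hF1] with x h1 h2 h3
      have a1 : ∀ n, (|(μ[f|ℱ n]) x| * |(μ[g|ℱ n]) x|) ^ p * v x ≤ (F x).toReal := fun n =>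
        (ENNReal.ofReal_le_iff_le_toReal h3.ne).1
          (le_iSup (fun n => ENNReal.ofReal ((|(μ[f|ℱ n]) x| * |(μ[g|ℱ n]) x|) ^ p * v x)) n)
      have a2 : (|f x| * |g x|) ^ p * v x ≤ (F x).toReal :=
        le_of_tendsto' (((h1.abs.mul h2.abs).rpow_const (Or.inr hp0.le)).mul_const (v x)) a1
      rw [Real.norm_of_nonneg (mul_nonneg (Real.rpow_nonneg (abs_nonneg _) _) (hv0 x))]
      have a3 : |(μ[f|ℱ n]) x * (μ[g|ℱ n]) x - f x * g x| ≤
          |(μ[f|ℱ n]) x| * |(μ[g|ℱ n]) x| + |f x| * |g x| := by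
        rw [← abs_mul, ← abs_mul]; exact abs_sub _ _
      have a4 : ∀ s t : ℝ, 0 ≤ s → s ≤ t → |(μ[f|ℱ n]) x * (μ[g|ℱ n]) x - f x * g x| ≤ s + t →
          t ^ p * v x ≤ (F x).toReal →
          |(μ[f|ℱ n]) x * (μ[g|ℱ n]) x - f x * g x| ^ p * v x ≤ 2 ^ p * (F x).toReal := by
        intro s t hs hst h hF
        calc _ ≤ (2 * t) ^ p * v x := by
              refine mul_le_mul_of_nonneg_right ?_ (hv0 x)
              exact Real.rpow_le_rpow (abs_nonneg _) (by linarith) hp0.le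
          _ = 2 ^ p * (t ^ p * v x) := by
              rw [Real.mul_rpow (by norm_num) (by linarith), mul_assoc]
          _ ≤ _ := mul_le_mul_of_nonneg_left hF (by positivity)
      rcases le_total (|(μ[f|ℱ n]) x| * |(μ[g|ℱ n]) x|) (|f x| * |g x|) with h | h
      · exact a4 _ _ (by positivity) h a3 a2
      · exact a4 _ _ (by positivity) h (by linarith) (a1 n)

end
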